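/- arXiv:math/9910052 — 2 statements merged into one kernel-verified Lean document; each statement's English description precedes it below -/
import Mathlib

section
/- For every natural number n, the complexified Clifford algebra ℂ ⊗_ℝ CLIF(ℝ^{2n}) of the even-dimensional euclidean space is a simple ring: its only two-sided ideals are the zero ideal and the whole ring (equivalently, its unique irreducible module is the 2ⁿ-dimensional spinor module). -/
open scoped RealInnerProductSpace TensorProduct

/-- If `b` is a family of units whose members are separated by the scalars through
which they commute with the units `u i`, then a two-sided ideal containing a nonzero combination
of the `b k` is everything. -/
theorem TwoSidedIdeal.eq_top_of_sum_smul_mem {K A ι κ : Type*} [Field K] [Ring A] [Algebra K A]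
    {u : ι → Aˣ} {b : κ → A} {ε : ι → κ → K}
    (hub : ∀ i k, u i * b k = ε i k • (b k * u i))
    (hε : ∀ k l, k ≠ l → ∃ i, ε i k ≠ ε i l) (hb : ∀ k, IsUnit (b k))
    {I : TwoSidedIdeal A} (s : Finset κ) (c : κ → K)
    (hmem : ∑ k ∈ s, c k • b k ∈ I) (hne : ∑ k ∈ s, c k • b k ≠ 0) : I = ⊤ := by
  classical
  induction s using Finset.strongInduction generalizing c with
  | H s ih =>
  have smul_mem (a : K) {x : A} (hx : x ∈ I) : a • x ∈ I := by
    rw [Algebra.smul_def]; exact I.mul_mem_left _ _ hx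
  have commutator (i : ι) (k : κ) :
      ∑ l ∈ s.erase k, (c l * (ε i l - ε i k)) • b l =
        u i * (∑ l ∈ s, c l • b l) * ↑(u i)⁻¹ - ε i k • ∑ l ∈ s, c l • b l := by
    have hdiag : (c k * (ε i k - ε i k)) • b k = 0 := by simp
    rw [Finset.sum_erase (f := fun l => (c l * (ε i l - ε i k)) • b l) s hdiag, Finset.mul_sum,
      Finset.sum_mul, Finset.smul_sum, ← Finset.sum_sub_distrib]
    refine Finset.sum_congr rfl fun l _ => ?_
    rw [mul_smul_comm, hub, smul_mul_assoc, smul_mul_assoc, Units.mul_inv_cancel_right,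
      smul_smul, smul_smul, ← sub_smul]
    ring_nf
  have commutator_mem (i : ι) (k : κ) :
      ∑ l ∈ s.erase k, (c l * (ε i l - ε i k)) • b l ∈ I := by
    rw [commutator]
    exact I.sub_mem (I.mul_mem_right _ _ (I.mul_mem_left _ _ hmem)) (smul_mem _ hmem)
  have hs : s.Nonempty := Finset.nonempty_of_sum_ne_zero hne
  obtain ⟨k, rfl⟩ | ⟨k, hk, l, hl, hkl⟩ := hs.exists_eq_singleton_or_nontrivial
  · rw [Finset.sum_singleton] at hmem hne
    obtain ⟨v, hv⟩ := hb k
    have hc : c k ≠ 0 := left_ne_zero_of_smul hne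
    rw [← I.one_mem_iff]
    have := I.mul_mem_right _ ↑v⁻¹ (smul_mem (c k)⁻¹ hmem)
    rwa [inv_smul_smul₀ hc, ← hv, Units.mul_inv] at this
  · obtain ⟨i, hi⟩ := hε k l hkl
    by_cases hzero : ∑ j ∈ s.erase k, (c j * (ε i j - ε i k)) • b j = 0
    · refine ih _ (Finset.erase_ssubset hl) _ (commutator_mem i l) fun hzero' => ?_
      rw [commutator, sub_eq_zero] at hzero hzero'
      rw [hzero, ← sub_eq_zero, ← sub_smul] at hzero'
      exact (smul_ne_zero (sub_ne_zero.2 hi) hne) hzero'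
    · exact ih _ (Finset.erase_ssubset hk) _ (commutator_mem i k) hzero

section Anticommute

variable {K A ι : Type*} [Field K] [Ring A] [Algebra K A]

/-- Moving a generator past a monomial in anticommuting generators; occurrences of the generator
itself do not contribute to the sign. -/
theorem List.mul_prod_map_of_anticommute {e : ι → A} [DecidableEq ι]
    (he : ∀ i j, i ≠ j → e i * e j = -(e j * e i)) (i : ι) (l : List ι) :
    e i * (l.map e).prod = (-1 : K) ^ (l.length + l.count i) • ((l.map e).prod * e i) := by
  induction l with
  | nil => simp
  | cons j l ih =>
    rcases eq_or_ne j i with rfl | hij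
    · simp only [List.map_cons, List.prod_cons, List.length_cons, List.count_cons_self]
      rw [mul_assoc (e j), ih, show l.length + 1 + (l.count j + 1) = l.length + l.count j + 2 by ring,
        pow_add _ _ 2, neg_one_sq, mul_one, mul_smul_comm]
    · simp only [List.map_cons, List.prod_cons, List.length_cons, List.count_cons_of_ne hij]
      rw [← mul_assoc, he i j hij.symm, neg_mul, mul_assoc, ih, add_right_comm, pow_succ]
      simp [mul_assoc]

/-- Permuting a monomial in anticommuting generators only changes it by a scalar. -/
theorem List.Perm.prod_map_of_anticommute {e : ι → A}
    (he : ∀ i j, i ≠ j → e i * e j = -(e j * e i)) {l l' : List ι} (h : l.Perm l') :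
    ∃ a : K, (l.map e).prod = a • (l'.map e).prod := by
  induction h with
  | nil => exact ⟨1, by simp⟩
  | cons i _ ih =>
    obtain ⟨a, ha⟩ := ih
    exact ⟨a, by simp [ha]⟩
  | swap i j l =>
    rcases eq_or_ne i j with rfl | hij
    · exact ⟨1, by simp⟩
    · refine ⟨-1, ?_⟩
      simp [← mul_assoc, he i j hij]
  | trans _ _ ih ih' =>
    obtain ⟨a, ha⟩ := ih
    obtain ⟨a', ha'⟩ := ih'
    exact ⟨a * a', by rw [ha, ha', smul_smul]⟩

/-- A monomial in anticommuting generators with scalar squares is a multiple of a squarefree one. -/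
theorem List.exists_prod_map_eq_smul_toList {e : ι → A} {q : ι → K}
    (he : ∀ i j, i ≠ j → e i * e j = -(e j * e i))
    (hq : ∀ i, e i * e i = algebraMap K A (q i)) (l : List ι) :
    ∃ (s : Finset ι) (a : K), (l.map e).prod = a • (s.toList.map e).prod := by
  classical
  induction l with
  | nil => exact ⟨∅, 1, by simp⟩
  | cons i l ih =>
    obtain ⟨s, a, ha⟩ := ih
    by_cases hi : i ∈ s
    · have hperm : s.toList.Perm (i :: (s.erase i).toList) := by
        simpa [Finset.insert_erase hi] using Finset.toList_insert (Finset.notMem_erase i s)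
      obtain ⟨a', ha'⟩ := hperm.prod_map_of_anticommute (K := K) he
      refine ⟨s.erase i, a * a' * q i, ?_⟩
      rw [List.map_cons, List.prod_cons, ha, ha', List.map_cons, List.prod_cons, smul_smul,
        mul_smul_comm, ← mul_assoc, hq, ← Algebra.smul_def, smul_smul]
    · obtain ⟨a', ha'⟩ := (Finset.toList_insert hi).symm.prod_map_of_anticommute (K := K) he
      refine ⟨insert i s, a * a', ?_⟩
      rw [List.map_cons, List.prod_cons] at ha' ⊢
      rw [ha, mul_smul_comm, ha', smul_smul]

/-- If the number of generators is even, the squarefree monomials are separated by the signs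
through which they commute with the generators. -/
theorem Finset.exists_neg_one_pow_card_add_count_ne [Fintype ι] [DecidableEq ι] [NeZero (2 : K)]
    (hι : Even (Fintype.card ι)) {s t : Finset ι} (hst : s ≠ t) :
    ∃ i, (-1 : K) ^ (s.toList.length + s.toList.count i) ≠
      (-1 : K) ^ (t.toList.length + t.toList.count i) := by
  have hone : (1 : K) ≠ -1 := fun h => two_ne_zero (α := K) (by linear_combination h)
  have count_toList (r : Finset ι) (i : ι) : r.toList.count i = if i ∈ r then 1 else 0 := by
    rw [List.Nodup.count r.nodup_toList]
    simp only [Finset.mem_toList]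
  suffices ∃ i, ¬ (Even (s.toList.length + s.toList.count i) ↔
      Even (t.toList.length + t.toList.count i)) by
    obtain ⟨i, hi⟩ := this
    refine ⟨i, fun h => hi ?_⟩
    rw [neg_one_pow_eq_ite, neg_one_pow_eq_ite] at h
    grind
  simp only [count_toList, Finset.length_toList]
  by_contra! h
  by_cases hcard : Even s.card ↔ Even t.card
  · refine hst (Finset.ext fun i => ?_)
    have := h i
    by_cases hs : i ∈ s <;> by_cases ht : i ∈ t <;>
      simp only [hs, ht, if_true, if_false, Nat.even_add_one, add_zero] at this ⊢ <;> tauto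
  · have : t = sᶜ := by
      ext i
      have := h i
      rw [Finset.mem_compl]
      by_cases hs : i ∈ s <;> by_cases ht : i ∈ t <;>
        simp only [hs, ht, if_true, if_false, Nat.even_add_one, add_zero] at this ⊢ <;> tauto
    rw [← Finset.card_add_card_compl s, ← this, Nat.even_add] at hι
    exact hcard hι

/-- An algebra generated by an even number of pairwise anticommuting elements with nonzero scalar
squares is simple in characteristic other than two. -/
theorem IsSimpleRing.of_anticommute [Nontrivial A] [Fintype ι] [NeZero (2 : K)]
    (hι : Even (Fintype.card ι)) {e : ι → A} {q : ι → K}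
    (he : ∀ i j, i ≠ j → e i * e j = -(e j * e i))
    (hq : ∀ i, e i * e i = algebraMap K A (q i)) (hq₀ : ∀ i, q i ≠ 0)
    (hspan : Algebra.adjoin K (Set.range e) = ⊤) : IsSimpleRing A := by
  classical
  have hunit (i : ι) : IsUnit (e i) := by
    have h : IsUnit (e i * e i) := hq i ▸ (hq₀ i).isUnit.map (algebraMap K A)
    exact ((Commute.refl (e i)).isUnit_mul_iff.1 h).1
  choose u hu using hunit
  let b (s : Finset ι) : A := (s.toList.map e).prod
  have hb : Submodule.span K (Set.range b) = ⊤ := by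
    rw [eq_top_iff, ← Algebra.top_toSubmodule, ← hspan, Algebra.adjoin_eq_span,
      Submodule.span_le]
    intro x hx
    obtain ⟨l, hl, rfl⟩ := Submonoid.exists_list_of_mem_closure hx
    obtain ⟨l, rfl⟩ : l ∈ Set.range (List.map e) := by rwa [Set.range_list_map]
    obtain ⟨s, a, ha⟩ := List.exists_prod_map_eq_smul_toList he hq l
    rw [ha]
    exact Submodule.smul_mem _ _ (Submodule.subset_span ⟨s, rfl⟩)
  refine ⟨⟨fun I => ?_⟩⟩
  rw [or_iff_not_imp_left]
  intro hI
  obtain ⟨x, hx, hx₀⟩ : ∃ x ∈ I, x ≠ 0 := by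
    by_contra! h
    exact hI (eq_bot_iff.2 fun x hx => by simpa using h x hx)
  obtain ⟨c, rfl⟩ := (Submodule.mem_span_range_iff_exists_fun K).1 (hb ▸ Submodule.mem_top (x := x))
  refine TwoSidedIdeal.eq_top_of_sum_smul_mem (u := u) (b := b)
    (ε := fun i s => (-1 : K) ^ (s.toList.length + s.toList.count i)) (fun i s => ?_)
    (fun s t hst => Finset.exists_neg_one_pow_card_add_count_ne hι hst) (fun s => ?_)
    Finset.univ c hx hx₀
  · rw [hu]
    exact List.mul_prod_map_of_anticommute he i _
  · exact Submonoid.list_prod_mem (IsUnit.submonoid A) <| by simp [IsUnit.mem_submonoid_iff, ← hu]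

end Anticommute

/-- The complexified Clifford algebra `ℂ ⊗ CLIF(ℝ^{2n})` of even-dimensional
euclidean space is a simple ring: its only two-sided ideals are `⊥` and `⊤`. -/
theorem complexified_clifford_even_dim_simple (n : ℕ)
    (Q : ∀ m : ℕ, QuadraticForm ℝ (EuclideanSpace ℝ (Fin m)))
    (hQ : ∀ (m : ℕ) (x : EuclideanSpace ℝ (Fin m)), Q m x = -⟪x, x⟫) :
    IsSimpleRing (ℂ ⊗[ℝ] CliffordAlgebra (Q (2 * n))) := by
  let v := EuclideanSpace.basisFun (Fin (2 * n)) ℝ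
  let e (i : Fin (2 * n)) := CliffordAlgebra.ι (Q (2 * n)) (v i)
  have hadjoin : Algebra.adjoin ℝ (Set.range e) = ⊤ := by
    rw [eq_top_iff, ← CliffordAlgebra.adjoin_range_ι, Algebra.adjoin_le_iff]
    rintro _ ⟨x, rfl⟩
    rw [← v.sum_repr x, map_sum]
    refine sum_mem fun i _ => ?_
    rw [map_smul]
    exact Subalgebra.smul_mem _ (Algebra.subset_adjoin (Set.mem_range_self i)) _
  refine IsSimpleRing.of_anticommute (K := ℂ) (by simp)
    (e := fun i => 1 ⊗ₜ e i) (q := fun _ => -1) ?_ ?_ (by simp) ?_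
  · intro i j hij
    have hortho : (Q (2 * n)).IsOrtho (v i) (v j) := by
      have hi := v.orthonormal.inner_eq_zero hij
      rw [QuadraticMap.isOrtho_def]
      simp only [hQ, inner_add_left, inner_add_right, hi, real_inner_comm]
      ring
    simp only [e, Algebra.TensorProduct.tmul_mul_tmul,
      CliffordAlgebra.ι_mul_ι_comm_of_isOrtho hortho, TensorProduct.tmul_neg]
  · intro i
    simp [e, v, hQ, TensorProduct.tmul_neg, TensorProduct.neg_tmul]
  · rw [Set.range_comp' (fun x => (1 : ℂ) ⊗ₜ[ℝ] x) e]
    exact Algebra.TensorProduct.adjoin_one_tmul_image_eq_top _ hadjoin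
end

section
/- For every natural number n, there exists a simple left module S over the ℂ-algebra A := ℂ ⊗_ℝ CLIF(ℝ^{2n}) such that A, regarded as a left module over itself, is isomorphic as an A-module to the direct sum of 2ⁿ copies of S (i.e. A ≅ S^{⊕2ⁿ} as left A-modules). -/
open scoped RealInnerProductSpace TensorProduct

/-- Column vectors form a simple module over the full matrix algebra of a field. -/
theorem Matrix.isSimpleModule_pi (ι K : Type*) [Fintype ι] [DecidableEq ι] [Nonempty ι]
    [Field K] : IsSimpleModule (Matrix ι ι K) (ι → K) := by
  rw [isSimpleModule_iff_toSpanSingleton_surjective]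
  refine ⟨inferInstance, fun v hv w => ?_⟩
  obtain ⟨j, hj⟩ := Function.ne_iff.mp hv
  refine ⟨Matrix.vecMulVec w (Pi.single j (v j)⁻¹), ?_⟩
  ext i
  rw [LinearMap.toSpanSingleton_apply, Matrix.smul_eq_mulVec, Matrix.vecMulVec_mulVec]
  simp [inv_mul_cancel₀ hj]

/-- The matrix algebra is, as a left module over itself, the direct sum of its columns. -/
def Matrix.columnsLinearEquiv (ι K : Type*) [Fintype ι] [DecidableEq ι] [Field K] :
    Matrix ι ι K ≃ₗ[Matrix ι ι K] (ι → ι → K) where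
  toFun A := A.transpose
  invFun B := Matrix.transpose B
  map_add' _ _ := rfl
  map_smul' _ _ := rfl
  left_inv _ := rfl
  right_inv _ := rfl

/-- A ring isomorphic to a matrix ring over a field is, as a left module over itself, a direct sum
of copies of a simple module. -/
theorem RingEquiv.exists_isSimpleModule_pi_linearEquiv {R ι K : Type} [Ring R] [Fintype ι]
    [DecidableEq ι] [Nonempty ι] [Field K] (e : R ≃+* Matrix ι ι K) {k : ℕ}
    (hk : Fintype.card ι = k) :
    ∃ (S : Type) (_ : AddCommGroup S) (_ : Module R S),
      IsSimpleModule R S ∧ Nonempty (R ≃ₗ[R] (Fin k → S)) := by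
  let _ : Module R (ι → K) := Module.compHom (ι → K) e.toRingHom
  refine ⟨ι → K, inferInstance, inferInstance, ?_, ⟨?_⟩⟩
  · have : RingHomSurjective e.toRingHom := ⟨e.surjective⟩
    let l : (ι → K) →ₛₗ[e.toRingHom] (ι → K) :=
      { toFun := id
        map_add' := fun _ _ => rfl
        map_smul' := fun _ _ => rfl }
    exact (LinearMap.isSimpleModule_iff_of_bijective l Function.bijective_id).mpr
      (Matrix.isSimpleModule_pi ι K)
  · let c : R ≃ₗ[R] (ι → ι → K) :=
      { e.toAddEquiv.trans (Matrix.columnsLinearEquiv ι K).toAddEquiv with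
        map_smul' := fun r x => by
          change Matrix.columnsLinearEquiv ι K (e (r * x)) =
            e r • Matrix.columnsLinearEquiv ι K (e x)
          rw [map_mul, ← smul_eq_mul, map_smul] }
    exact c.trans (LinearEquiv.funCongrLeft R (ι → K) (Fintype.equivFinOfCardEq hk).symm)

open Matrix in
/-- If `s` generates the matrix algebra, and a subalgebra of the `2 × 2` block matrices contains
the two extra Clifford generators and `diag (a, -a)` for `a ∈ s`, then it is everything. -/
theorem Subalgebra.eq_top_of_fromBlocks_mem {ι : Type*} [Fintype ι] [DecidableEq ι]
    {s : Set (Matrix ι ι ℂ)} (hs : Algebra.adjoin ℂ s = ⊤)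
    (B : Subalgebra ℂ (Matrix (ι ⊕ ι) (ι ⊕ ι) ℂ))
    (h₁ : fromBlocks 0 1 (-1) 0 ∈ B)
    (h₂ : fromBlocks 0 (Complex.I • 1) (Complex.I • 1) 0 ∈ B)
    (hB : ∀ a ∈ s, fromBlocks a 0 0 (-a) ∈ B) : B = ⊤ := by
  have hII : ∀ a : Matrix ι ι ℂ, Complex.I • Complex.I • a = -a := fun a => by
    rw [smul_smul, Complex.I_mul_I, neg_one_smul]
  have hz : fromBlocks 1 0 0 (-1) ∈ B := by
    have := B.neg_mem (B.smul_mem (B.mul_mem h₁ h₂) Complex.I)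
    simpa [-neg_mem_iff, fromBlocks_multiply, fromBlocks_smul, fromBlocks_neg, hII] using this
  have hhalf : ∀ a : Matrix ι ι ℂ, (2⁻¹ : ℂ) • (a + a) = a := fun a => by
    rw [← two_smul ℂ a, smul_smul]; norm_num
  have hp : fromBlocks 1 0 0 0 ∈ B := by
    have := B.smul_mem (B.add_mem B.one_mem hz) (2⁻¹ : ℂ)
    rw [← fromBlocks_one, fromBlocks_add, fromBlocks_smul] at this
    simpa [-smul_add, hhalf] using this
  have hq : fromBlocks 0 0 0 1 ∈ B := by
    have := B.sub_mem B.one_mem hp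
    rw [← fromBlocks_one, sub_eq_add_neg, fromBlocks_neg, fromBlocks_add] at this
    simpa using this
  have hu : fromBlocks 0 1 0 0 ∈ B := by
    simpa [fromBlocks_multiply] using B.mul_mem hp h₁
  have hl : fromBlocks 0 0 1 0 ∈ B := by
    simpa [fromBlocks_multiply, fromBlocks_neg] using B.neg_mem (B.mul_mem hq h₁)
  have hd : ∀ a : Matrix ι ι ℂ, fromBlocks a 0 0 0 ∈ B := fun a => by
    have ha : a ∈ Algebra.adjoin ℂ s := hs ▸ Algebra.mem_top
    induction ha using Algebra.adjoin_induction with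
    | mem x hx => simpa [fromBlocks_multiply] using B.mul_mem hp (hB x hx)
    | algebraMap r =>
      simpa [fromBlocks_smul, Algebra.algebraMap_eq_smul_one] using B.smul_mem hp r
    | add x y _ _ hx hy => simpa [fromBlocks_add] using B.add_mem hx hy
    | mul x y _ _ hx hy => simpa [fromBlocks_multiply] using B.mul_mem hx hy
  refine eq_top_iff.mpr fun M _ => ?_
  rw [← fromBlocks_toBlocks M]
  have := B.add_mem (B.add_mem (hd M.toBlocks₁₁) (B.mul_mem (hd M.toBlocks₁₂) hu))
    (B.add_mem (B.mul_mem hl (hd M.toBlocks₂₁)) (B.mul_mem (B.mul_mem hl (hd M.toBlocks₂₂)) hu))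
  simpa [fromBlocks_multiply, fromBlocks_add] using this

/-- Complex gamma matrices: a Clifford map from `ℝ^{2n}` to the complex matrices of size `2ⁿ`
whose image generates all matrices. -/
theorem exists_gammaMatrices (n : ℕ) :
    ∃ (ι : Type) (_ : Fintype ι) (_ : DecidableEq ι) (f : (Fin (2 * n) → ℝ) →ₗ[ℝ] Matrix ι ι ℂ),
      Fintype.card ι = 2 ^ n ∧ (∀ x, f x * f x = (-∑ i, x i ^ 2) • (1 : Matrix ι ι ℂ)) ∧
      Algebra.adjoin ℂ (Set.range f) = ⊤ := by
  induction n with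
  | zero =>
    refine ⟨Unit, inferInstance, inferInstance, 0, by simp, fun x => by simp, ?_⟩
    refine eq_top_iff.mpr fun M _ => ?_
    have : M = algebraMap ℂ _ (M () ()) := by ext; simp [Matrix.algebraMap_matrix_apply]
    rw [this]
    exact Subalgebra.algebraMap_mem _ _
  | succ n ih =>
    obtain ⟨ι, _, _, f, hcard, hf, htop⟩ := ih
    let g : (Fin (2 * n + 2) → ℝ) →ₗ[ℝ] Matrix (ι ⊕ ι) (ι ⊕ ι) ℂ :=
      { toFun := fun x => Matrix.fromBlocks (f fun i => x i.succ.succ)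
          (((x 0 : ℂ) + x 1 * Complex.I) • 1) ((-(x 0 : ℂ) + x 1 * Complex.I) • 1)
          (-f fun i => x i.succ.succ)
        map_add' := fun x y => by
          have : (fun i : Fin (2 * n) => (x + y) i.succ.succ) =
            (fun i => x i.succ.succ) + fun i => y i.succ.succ := rfl
          rw [Matrix.fromBlocks_add, this, map_add, ← add_smul, ← add_smul]
          congr 1
          · congr 1; simp; ring
          · congr 1; simp; ring
          · abel
        map_smul' := fun r x => by
          have : (fun i : Fin (2 * n) => (r • x) i.succ.succ) =
            r • (fun i => x i.succ.succ) := rfl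
          rw [Matrix.fromBlocks_smul, this, map_smul, RingHom.id_apply, ← smul_assoc,
            ← smul_assoc, smul_neg]
          congr 2
          · simp; ring
          · simp; ring }
    have hg : ∀ x, g x = Matrix.fromBlocks (f fun i => x i.succ.succ)
          (((x 0 : ℂ) + x 1 * Complex.I) • 1) ((-(x 0 : ℂ) + x 1 * Complex.I) • 1)
          (-f fun i => x i.succ.succ) := fun _ => rfl
    refine ⟨ι ⊕ ι, inferInstance, inferInstance, g, ?_, fun x => ?_, ?_⟩
    · rw [Fintype.card_sum, hcard]; ring
    · have hc : ((x 0 : ℂ) + x 1 * Complex.I) * (-(x 0 : ℂ) + x 1 * Complex.I) =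
          ((-(x 0 ^ 2 + x 1 ^ 2) : ℝ) : ℂ) := by
        push_cast
        linear_combination (x 1 : ℂ) ^ 2 * Complex.I_sq
      have hsum : ∑ i, x i ^ 2 = x 0 ^ 2 + x 1 ^ 2 + ∑ i : Fin (2 * n), x i.succ.succ ^ 2 := by
        change ∑ i : Fin (2 * n + 2), x i ^ 2 = _
        rw [Fin.sum_univ_succ, Fin.sum_univ_succ, ← add_assoc]
        rfl
      rw [hsum, hg, Matrix.fromBlocks_multiply, ← Matrix.fromBlocks_one, Matrix.fromBlocks_smul]
      simp only [neg_mul_neg, hf, smul_mul_smul_comm, one_mul, hc, mul_comm (-(x 0 : ℂ) + _),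
        Complex.coe_smul, ← add_smul]
      congr 1
      · congr 1; ring
      · simp
      · simp
      · congr 1; ring
    · refine Subalgebra.eq_top_of_fromBlocks_mem htop _ ?_ ?_ ?_
      · refine Algebra.subset_adjoin ⟨Pi.single 0 1, ?_⟩
        have : (fun i : Fin (2 * n) => (Pi.single 0 1 : Fin (2 * n + 2) → ℝ) i.succ.succ) = 0 := by
          ext i; simp
        rw [hg, this]; simp
      · refine Algebra.subset_adjoin ⟨Pi.single 1 1, ?_⟩
        have : (fun i : Fin (2 * n) => (Pi.single 1 1 : Fin (2 * n + 2) → ℝ) i.succ.succ) = 0 := by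
          ext i; simp [Fin.ext_iff]
        rw [hg, this]; simp
      · rintro _ ⟨y, rfl⟩
        refine Algebra.subset_adjoin ⟨Fin.cons 0 (Fin.cons 0 y : Fin (2 * n + 1) → ℝ), ?_⟩
        rw [hg]
        have : (Fin.cons 0 (Fin.cons 0 y : Fin (2 * n + 1) → ℝ) : Fin (2 * n + 2) → ℝ) 1 = 0 := rfl
        simp [this]

/-- A Clifford algebra over a ring in which `2` is invertible has a basis indexed by the finite
subsets of the index set of a basis of the underlying module. -/
theorem CliffordAlgebra.nonempty_basis {R M I : Type*} [CommRing R] [Invertible (2 : R)]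
    [AddCommGroup M] [Module R M] [LinearOrder I] (Q : QuadraticForm R M)
    (b : Module.Basis I R M) : Nonempty (Module.Basis (Finset I) R (CliffordAlgebra Q)) :=
  ⟨b.ExteriorAlgebra.map (CliffordAlgebra.equivExterior Q).symm⟩

/-- There is a simple left module `S` over `A := ℂ ⊗ CLIF(ℝ^{2n})` such that
`A`, as a left module over itself, is isomorphic to the direct sum of `2ⁿ` copies of `S`. -/
theorem complexified_clifford_decomposes_into_spinor_modules (n : ℕ)
    (Q : ∀ m : ℕ, QuadraticForm ℝ (EuclideanSpace ℝ (Fin m)))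
    (hQ : ∀ (m : ℕ) (x : EuclideanSpace ℝ (Fin m)), Q m x = -⟪x, x⟫) :
    ∃ (S : Type) (_ : AddCommGroup S) (_ : Module (ℂ ⊗[ℝ] CliffordAlgebra (Q (2 * n))) S),
      IsSimpleModule (ℂ ⊗[ℝ] CliffordAlgebra (Q (2 * n))) S ∧
      Nonempty ((ℂ ⊗[ℝ] CliffordAlgebra (Q (2 * n))) ≃ₗ[ℂ ⊗[ℝ] CliffordAlgebra (Q (2 * n))]
        (Fin (2 ^ n) → S)) := by
  obtain ⟨ι, _, _, f, hcard, hf, htop⟩ := exists_gammaMatrices n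
  have : Nonempty ι := Fintype.card_pos_iff.mp (hcard ▸ by positivity)
  let γ : EuclideanSpace ℝ (Fin (2 * n)) →ₗ[ℝ] Matrix ι ι ℂ :=
    f ∘ₗ (WithLp.linearEquiv 2 ℝ (Fin (2 * n) → ℝ)).toLinearMap
  have hγ : ∀ x, γ x * γ x = algebraMap ℝ _ (Q (2 * n) x) := fun x => by
    rw [hQ, real_inner_self_eq_norm_sq, EuclideanSpace.real_norm_sq_eq,
      Algebra.algebraMap_eq_smul_one]
    exact hf x.ofLp
  let F : ℂ ⊗[ℝ] CliffordAlgebra (Q (2 * n)) →ₐ[ℂ] Matrix ι ι ℂ :=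
    Algebra.TensorProduct.lift (Algebra.ofId ℂ _) (CliffordAlgebra.lift _ ⟨γ, hγ⟩)
      fun z _ => Algebra.commutes z _
  have hsurj : Function.Surjective F := by
    rw [← AlgHom.range_eq_top, eq_top_iff, ← htop, Algebra.adjoin_le_iff]
    rintro _ ⟨x, rfl⟩
    refine ⟨1 ⊗ₜ CliffordAlgebra.ι _ (WithLp.toLp 2 x), ?_⟩
    refine (Algebra.TensorProduct.lift_tmul _ _ _ _ _).trans ?_
    rw [map_one, one_mul, CliffordAlgebra.lift_ι_apply]
    rfl
  obtain ⟨b⟩ := CliffordAlgebra.nonempty_basis (Q (2 * n))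
    (EuclideanSpace.basisFun (Fin (2 * n)) ℝ).toBasis
  have : Module.Finite ℝ (CliffordAlgebra (Q (2 * n))) := .of_basis b
  have hrank : Module.finrank ℂ (ℂ ⊗[ℝ] CliffordAlgebra (Q (2 * n))) =
      Module.finrank ℂ (Matrix ι ι ℂ) := by
    rw [Module.finrank_baseChange, Module.finrank_eq_card_basis b, Module.finrank_matrix, hcard]
    simp
    ring
  have hinj : Function.Injective F :=
    (LinearMap.injective_iff_surjective_of_finrank_eq_finrank (f := F.toLinearMap) hrank).mpr hsurj
  exact (RingEquiv.ofBijective F ⟨hinj, hsurj⟩).exists_isSimpleModule_pi_linearEquiv hcard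
end
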